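/- Let 𝓡̃ = (ℝ, <, 0, +, …) be a locally o-minimal expansion of the ordered additive group of real numbers. Then 𝓡̃ ⊨ SLUF; that is, for every definable set X ⊆ ℝ^{m+1} and every a ∈ ℝ there exist a positive integer N and a closed interval I with a ∈ int(I) — where I may be chosen independently of X — such that for every x ∈ ℝ^m and every closed interval J with a ∈ int(J) ⊆ I, either |X_x ∩ J| = ∞ or |X_x ∩ J| ≤ N. -/

import Mathlib

open FirstOrder Set Topology

section CommonDefs

/-- A subset of `R^n` (coded as `Fin n → R`) is definable in the structure `𝓡` (with
universe `R` and language `L`) with parameters. -/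
def IsDefinable (L : FirstOrder.Language) {R : Type*} [L.Structure R] {n : ℕ}
    (X : Set (Fin n → R)) : Prop :=
  Set.Definable (Set.univ : Set R) L X

/-- An open box in `R^n`: a product of `n` open intervals. -/
def OpenBox {R : Type*} [LT R] {n : ℕ} (B : Set (Fin n → R)) : Prop :=
  ∃ c d : Fin n → R, B = {x | ∀ i, c i < x i ∧ x i < d i}

/-- A closed box in `R^n`: a product of `n` closed intervals. -/
def ClosedBox {R : Type*} [LE R] {n : ℕ} (B : Set (Fin n → R)) : Prop :=
  ∃ c d : Fin n → R, B = {x | ∀ i, c i ≤ x i ∧ x i ≤ d i}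

/-- A subset of `R` which is a finite union of points and open intervals. -/
def FinUnionPtsIntervals {R : Type*} [Preorder R] (s : Set R) : Prop :=
  ∃ (P : Finset R) (Q : Finset (R × R)), s = ↑P ∪ ⋃ p ∈ Q, Set.Ioo p.1 p.2

/-- The fiber `X_x ⊆ R` of a set `X ⊆ R^{m+1}` over `x ∈ R^m`. -/
def fiber1 {R : Type*} {m : ℕ} (X : Set (Fin (m + 1) → R)) (x : Fin m → R) : Set R :=
  {y | Fin.snoc x y ∈ X}

/-- The fiber `X_x ⊆ R^n` of a set `X ⊆ R^{m+n}` over `x ∈ R^m`. -/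
def fiberN {R : Type*} {m n : ℕ} (X : Set (Fin (m + n) → R)) (x : Fin m → R) :
    Set (Fin n → R) :=
  {y | Fin.append x y ∈ X}

/-- The member `X_{r,s} ⊆ R^n` of a parameterized family coded by `F ⊆ R^{2+n}`. -/
def famFiber {R : Type*} {n : ℕ} (F : Set (Fin (2 + n) → R)) (r s : R) : Set (Fin n → R) :=
  {y | Fin.append ![r, s] y ∈ F}

/-- A bounded subset of `R^n`: contained in some closed box. -/
def BddSet {R : Type*} [LE R] {n : ℕ} (X : Set (Fin n → R)) : Prop :=
  ∃ c d : R, ∀ y ∈ X, ∀ i, c ≤ y i ∧ y i ≤ d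

/-- A discrete subset of a topological space: each of its points is isolated. -/
def DiscreteSet {α : Type*} [TopologicalSpace α] (S : Set α) : Prop :=
  ∀ y ∈ S, ∃ U : Set α, IsOpen U ∧ y ∈ U ∧ U ∩ S = {y}

/-- A locally finite subset: each point of the space has an open neighborhood meeting
the set in a finite set. -/
def LocFin {α : Type*} [TopologicalSpace α] (S : Set α) : Prop :=
  ∀ x : α, ∃ U : Set α, IsOpen U ∧ x ∈ U ∧ (S ∩ U).Finite

/-- `F ⊆ R^{2+n}` codes a `D_Σ`-family `{X_{r,s}}_{r>0,s>0}` of CBD subsets of `R^n`: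
each fiber is closed, bounded and definable, the family is increasing in `r` and
decreasing in `s`. -/
def IsDSigmaFamily (L : FirstOrder.Language) {R : Type*} [L.Structure R] [LinearOrder R]
    [Zero R] [TopologicalSpace R] {n : ℕ} (F : Set (Fin (2 + n) → R)) : Prop :=
  IsDefinable L F ∧
    (∀ r s : R, 0 < r → 0 < s →
      IsDefinable L (famFiber F r s) ∧ IsClosed (famFiber F r s) ∧ BddSet (famFiber F r s)) ∧
    (∀ r r' s : R, 0 < r → 0 < s → r ≤ r' → famFiber F r s ⊆ famFiber F r' s) ∧
    (∀ r s s' : R, 0 < r → 0 < s → s ≤ s' → famFiber F r s' ⊆ famFiber F r s)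

/-- A `D_Σ`-set: the union `⋃_{r>0,s>0} X_{r,s}` of a `D_Σ`-family. -/
def IsDSigma (L : FirstOrder.Language) {R : Type*} [L.Structure R] [LinearOrder R]
    [Zero R] [TopologicalSpace R] {n : ℕ} (X : Set (Fin n → R)) : Prop :=
  ∃ F : Set (Fin (2 + n) → R), IsDSigmaFamily L F ∧
    X = ⋃ (r : R) (_ : 0 < r) (s : R) (_ : 0 < s), famFiber F r s

/-- Constructible sets: finite boolean combinations of open sets. -/
inductive IsConstructibleSet {α : Type*} [TopologicalSpace α] : Set α → Prop
  | of_isOpen (s : Set α) : IsOpen s → IsConstructibleSet s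
  | compl (s : Set α) : IsConstructibleSet s → IsConstructibleSet sᶜ
  | union (s t : Set α) : IsConstructibleSet s → IsConstructibleSet t →
      IsConstructibleSet (s ∪ t)

/-- `𝓡 ⊨ DC`: every nonempty definable subset of `R` bounded above has a supremum. -/
def DCProp (L : FirstOrder.Language) (R : Type*) [L.Structure R] [Preorder R] : Prop :=
  ∀ s : Set R, IsDefinable L {v : Fin 1 → R | v 0 ∈ s} → s.Nonempty → BddAbove s →
    ∃ a : R, IsLUB s a

/-- `𝓡 ⊨ LUF₂` (locally uniform finiteness of the second kind). -/
def LUF2 (L : FirstOrder.Language) (R : Type*) [L.Structure R] [LinearOrder R]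
    [TopologicalSpace R] : Prop :=
  ∀ (m : ℕ) (X : Set (Fin (m + 1) → R)), IsDefinable L X → ∀ (a : R) (b : Fin m → R),
    ∃ N : ℕ, 0 < N ∧ ∃ p q : R, a ∈ interior (Set.Icc p q) ∧
      ∃ U : Set (Fin m → R), OpenBox U ∧ b ∈ U ∧
        ∀ x ∈ U, ∀ p' q' : R, a ∈ interior (Set.Icc p' q') → Set.Icc p' q' ⊆ Set.Icc p q →
          (fiber1 X x ∩ Set.Icc p' q').Infinite ∨ (fiber1 X x ∩ Set.Icc p' q').ncard ≤ N

/-- `𝓡 ⊨ LUF₁`: `LUF₂` with `U` always taken to be all of `R^m`. -/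
def LUF1 (L : FirstOrder.Language) (R : Type*) [L.Structure R] [LinearOrder R]
    [TopologicalSpace R] : Prop :=
  ∀ (m : ℕ) (X : Set (Fin (m + 1) → R)), IsDefinable L X → ∀ a : R,
    ∃ N : ℕ, 0 < N ∧ ∃ p q : R, a ∈ interior (Set.Icc p q) ∧
      ∀ (x : Fin m → R), ∀ p' q' : R,
        a ∈ interior (Set.Icc p' q') → Set.Icc p' q' ⊆ Set.Icc p q →
          (fiber1 X x ∩ Set.Icc p' q').Infinite ∨ (fiber1 X x ∩ Set.Icc p' q').ncard ≤ N

/-- `𝓡 ⊨ SLUF`: `LUF₁` with the interval `I` chosen independently of the definable set. -/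
def SLUF (L : FirstOrder.Language) (R : Type*) [L.Structure R] [LinearOrder R]
    [TopologicalSpace R] : Prop :=
  ∀ a : R, ∃ p q : R, a ∈ interior (Set.Icc p q) ∧
    ∀ (m : ℕ) (X : Set (Fin (m + 1) → R)), IsDefinable L X →
      ∃ N : ℕ, 0 < N ∧
        ∀ (x : Fin m → R), ∀ p' q' : R,
          a ∈ interior (Set.Icc p' q') → Set.Icc p' q' ⊆ Set.Icc p q →
            (fiber1 X x ∩ Set.Icc p' q').Infinite ∨ (fiber1 X x ∩ Set.Icc p' q').ncard ≤ N

/-- The language of the open core of `𝓡`: one `n`-ary relation symbol for each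
`𝓡`-definable open subset of `R^n`. -/
def openCoreLang (L : FirstOrder.Language) (R : Type*) [L.Structure R] [TopologicalSpace R] :
    FirstOrder.Language where
  Functions := fun _ => Empty
  Relations := fun n => { s : Set (Fin n → R) // Set.Definable (Set.univ : Set R) L s ∧ IsOpen s }

/-- The open core of `𝓡`: the structure on `R` interpreting each relation symbol by the
corresponding `𝓡`-definable open set. -/
def openCoreStructure (L : FirstOrder.Language) (R : Type*) [L.Structure R]
    [TopologicalSpace R] : (openCoreLang L R).Structure R where
  funMap := fun f _ => f.elim
  RelMap := fun s x => x ∈ s.1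

/-- A set is definable in the open core of `𝓡` if it is definable (with parameters) in the
structure generated by the `𝓡`-definable open sets. -/
def DefinableInOpenCore (L : FirstOrder.Language) (R : Type*) [L.Structure R]
    [TopologicalSpace R] {n : ℕ} (X : Set (Fin n → R)) : Prop :=
  letI := openCoreStructure L R
  Set.Definable (Set.univ : Set R) (openCoreLang L R) X

/-- The local dimension `dim_x X` of `X ⊆ R^n` at `x`, an element of `{-∞} ∪ ℕ ∪ {∞}`:
the supremum of the nonnegative integers `d` such that for every open box `B` containing
`x`, some coordinate projection of `B ∩ X` to `R^d` has nonempty interior (and `-∞` if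
some open box containing `x` misses `X`). -/
noncomputable def locDim {R : Type*} [LT R] [TopologicalSpace R] {n : ℕ}
    (X : Set (Fin n → R)) (x : Fin n → R) : WithBot ℕ∞ :=
  sSup {e : WithBot ℕ∞ | ∃ d : ℕ, e = ((d : ℕ∞) : WithBot ℕ∞) ∧
    ∀ B : Set (Fin n → R), OpenBox B → x ∈ B →
      ∃ f : Fin d → Fin n, Function.Injective f ∧
        (interior ((fun y => y ∘ f) '' (B ∩ X))).Nonempty}

/-- The dimension of `X ⊆ R^n`: the supremum of the local dimensions. -/
noncomputable def setDim {R : Type*} [LT R] [TopologicalSpace R] {n : ℕ}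
    (X : Set (Fin n → R)) : WithBot ℕ∞ :=
  ⨆ x : Fin n → R, locDim X x

/-- The projective dimension of `X ⊆ R^n`: the supremum of the nonnegative integers `d`
such that some coordinate projection of `X` to `R^d` has nonempty interior (`-∞` for the
empty set). -/
noncomputable def projDim {R : Type*} [TopologicalSpace R] {n : ℕ}
    (X : Set (Fin n → R)) : WithBot ℕ∞ :=
  sSup {e : WithBot ℕ∞ | ∃ d : ℕ, e = ((d : ℕ∞) : WithBot ℕ∞) ∧
    ∃ f : Fin d → Fin n, Function.Injective f ∧
      (interior ((fun y => y ∘ f) '' X)).Nonempty}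

/-- A subset of `R` which is a union of at most `N` open intervals. -/
def UnionAtMostOpenIntervals {R : Type*} [Preorder R] (N : ℕ) (s : Set R) : Prop :=
  ∃ Q : Finset (R × R), Q.card ≤ N ∧ s = ⋃ p ∈ Q, Set.Ioo p.1 p.2

/-- A subset of `R` which is a union of at most `N₁` points and `N₂` closed intervals. -/
def UnionAtMostPtsClosedIntervals {R : Type*} [Preorder R] (N₁ N₂ : ℕ) (s : Set R) : Prop :=
  ∃ (P : Finset R) (Q : Finset (R × R)), P.card ≤ N₁ ∧ Q.card ≤ N₂ ∧
    s = ↑P ∪ ⋃ p ∈ Q, Set.Icc p.1 p.2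

/-- A subset of `R` which is a union of at most `N₁` points and `N₂` open intervals. -/
def UnionAtMostPtsOpenIntervals {R : Type*} [Preorder R] (N₁ N₂ : ℕ) (s : Set R) : Prop :=
  ∃ (P : Finset R) (Q : Finset (R × R)), P.card ≤ N₁ ∧ Q.card ≤ N₂ ∧
    s = ↑P ∪ ⋃ p ∈ Q, Set.Ioo p.1 p.2

/-- `X ∩ B` is the graph of a continuous map defined on the coordinate-projection image
of `B` (the projection being given by the injection `f` of coordinates). -/
def IsGraphOn {R : Type*} [TopologicalSpace R] {n d : ℕ} (f : Fin d → Fin n)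
    (S : Set (Fin n → R)) (D : Set (Fin d → R)) : Prop :=
  ∃ g : (Fin d → R) → (Fin n → R), ContinuousOn g D ∧ (∀ z ∈ D, (g z) ∘ f = z) ∧ S = g '' D

end CommonDefs

/-- Local o-minimality of a single subset of the line. -/
def TameSet (S : Set ℝ) : Prop :=
  ∀ a : ℝ, ∃ c d : ℝ, c < a ∧ a < d ∧ FinUnionPtsIntervals (S ∩ Set.Ioo c d)

lemma TameSet.locFinite {S : Set ℝ} (h : TameSet S) (hi : interior S = ∅) (a : ℝ) :
    ∃ c d : ℝ, c < a ∧ a < d ∧ (S ∩ Ioo c d).Finite := by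
  obtain ⟨c, d, hc, hd, P, Q, hPQ⟩ := h a
  refine ⟨c, d, hc, hd, P.finite_toSet.subset ?_⟩
  intro x hx
  rw [hPQ] at hx
  rcases hx with hx | hx
  · exact hx
  · exfalso
    simp only [mem_iUnion] at hx
    obtain ⟨r, hr, hx⟩ := hx
    have : x ∈ interior S := by
      rw [mem_interior]
      refine ⟨Ioo r.1 r.2, ?_, isOpen_Ioo, hx⟩
      intro z hz
      have : z ∈ S ∩ Ioo c d := by
        rw [hPQ]; right; simp only [mem_iUnion]; exact ⟨r, hr, hz⟩
      exact this.1
    rw [hi] at this; exact this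

lemma TameSet.isClosed {S : Set ℝ} (h : TameSet S) (hi : interior S = ∅) : IsClosed S := by
  rw [← closure_subset_iff_isClosed]
  intro a ha
  obtain ⟨c, d, hc, hd, hf⟩ := h.locFinite hi a
  have h1 : a ∈ closure (S ∩ Ioo c d) := by
    rw [mem_closure_iff_nhds] at ha ⊢
    intro t ht
    obtain ⟨z, hz⟩ := ha (t ∩ Ioo c d) (Filter.inter_mem ht (Ioo_mem_nhds hc hd))
    exact ⟨z, hz.1.1, hz.2, hz.1.2⟩
  rw [hf.isClosed.closure_eq] at h1
  exact h1.1

lemma TameSet.finite_inter {S : Set ℝ} (h : TameSet S) (hi : interior S = ∅) (p q : ℝ) :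
    (S ∩ Icc p q).Finite := by
  refine isCompact_Icc.induction_on (p := fun t => (S ∩ t).Finite) (by simp) ?_ ?_ ?_
  · intro s t hst ht
    exact ht.subset (inter_subset_inter_right _ hst)
  · intro s t hs ht
    rw [inter_union_distrib_left]
    exact hs.union ht
  · intro x _
    obtain ⟨c, d, hc, hd, hf⟩ := h.locFinite hi x
    exact ⟨Ioo c d, mem_nhdsWithin_of_mem_nhds (Ioo_mem_nhds hc hd), hf⟩

lemma interior_empty_of_countable {S : Set ℝ} (h : S.Countable) : interior S = ∅ :=
  interior_eq_empty_iff_dense_compl.2 (h.dense_compl ℝ)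

lemma frontier_finUnion_finite {S : Set ℝ} (h : FinUnionPtsIntervals S) :
    (frontier S).Finite := by
  obtain ⟨P, Q, rfl⟩ := h
  have h2 : ∀ Q : Finset (ℝ × ℝ), (frontier (⋃ p ∈ Q, Ioo p.1 p.2)).Finite := by
    intro Q
    classical
    induction Q using Finset.induction_on with
    | empty => simp
    | insert a Q _ ih =>
      rw [Finset.set_biUnion_insert]
      refine Set.Finite.subset (Set.Finite.union (s := frontier (Ioo a.1 a.2)) ?_ ih)
        ((frontier_union_subset _ _).trans
          (union_subset_union inter_subset_left inter_subset_right))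
      by_cases hlt : a.1 < a.2
      · rw [frontier_Ioo hlt]; simp
      · rw [Ioo_eq_empty hlt]; simp
  refine Set.Finite.subset (Set.Finite.union (s := frontier (P : Set ℝ)) ?_ (h2 Q))
        ((frontier_union_subset _ _).trans
          (union_subset_union inter_subset_left inter_subset_right))
  exact P.finite_toSet.subset P.finite_toSet.isClosed.frontier_subset

lemma TameSet.countable_frontier {S : Set ℝ} (h : TameSet S) : (frontier S).Countable := by
  choose c d hc hd hf using h
  obtain ⟨T, hT, hU⟩ := TopologicalSpace.isOpen_iUnion_countable (fun a => Ioo (c a) (d a))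
    (fun a => isOpen_Ioo)
  have hcov : (⋃ a, Ioo (c a) (d a)) = univ :=
    eq_univ_of_forall fun x => mem_iUnion.2 ⟨x, hc x, hd x⟩
  have : frontier S ⊆ ⋃ a ∈ T, frontier (S ∩ Ioo (c a) (d a)) := by
    intro x hx
    have hxU : x ∈ ⋃ a ∈ T, Ioo (c a) (d a) := by rw [hU, hcov]; trivial
    simp only [mem_iUnion] at hxU ⊢
    obtain ⟨a, ha, hxa⟩ := hxU
    refine ⟨a, ha, ?_⟩
    have := frontier_inter_open_inter (s := S) (isOpen_Ioo (a := c a) (b := d a))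
    have h2 : x ∈ frontier S ∩ Ioo (c a) (d a) := ⟨hx, hxa⟩
    rw [← this] at h2
    exact h2.1
  exact (hT.biUnion fun a _ => (frontier_finUnion_finite (hf a)).countable).mono this

/-- The fiber over `x` misses `(c,d)`. -/
def NoneB (Y : ℝ → ℝ → Prop) (c d x : ℝ) : Prop := ∀ z, c < z → z < d → ¬ Y x z

/-- The fiber over `x` meets `(c,d)` in exactly one point. -/
def OneB (Y : ℝ → ℝ → Prop) (c d x : ℝ) : Prop :=
  ∃ z, c < z ∧ z < d ∧ Y x z ∧ ∀ z', c < z' → z' < d → Y x z' → z' = z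

/-- Over a neighbourhood of `a` the family looks like finitely many disjoint curves. -/
def GoodAt (Y : ℝ → ℝ → Prop) (a : ℝ) : Prop :=
  ∀ y e f, e < y → y < f → ∃ c d u w, e < c ∧ c < y ∧ y < d ∧ d < f ∧ u < a ∧ a < w ∧
    ((∀ x, u < x → x < w → NoneB Y c d x) ∨ (∀ x, u < x → x < w → OneB Y c d x))

lemma GoodAt.eventually_ncard {Y : ℝ → ℝ → Prop} {a p q : ℝ} (h : GoodAt Y a)
    (hfin : ∀ x, {y | Y x y}.Finite) (hb : ∀ x y, Y x y → y ∈ Icc p q) :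
    ∀ᶠ x in 𝓝 a, {y | Y x y}.ncard = {y | Y a y}.ncard := by
  obtain ⟨U, hU, hdis⟩ := (hfin a).t2_separation
  have h1 : ∀ y, ∃ V : Set ℝ, IsOpen V ∧ y ∈ V ∧ (Y a y → V ⊆ U y ∧
      ∀ᶠ x in 𝓝 a, ∃ z ∈ V, Y x z ∧ ∀ z' ∈ V, Y x z' → z' = z) ∧
      (¬ Y a y → ∀ᶠ x in 𝓝 a, ∀ z ∈ V, ¬ Y x z) := by
    intro y
    by_cases hy : Y a y
    · obtain ⟨e, f, ⟨he, hf⟩, hsub⟩ :=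
        mem_nhds_iff_exists_Ioo_subset.1 ((hU y).2.mem_nhds (hU y).1)
      obtain ⟨c, d, u, w, hec, hcy, hyd, hdf, hua, haw, hh⟩ := h y e f he hf
      refine ⟨Ioo c d, isOpen_Ioo, ⟨hcy, hyd⟩, fun _ => ⟨?_, ?_⟩, fun h => absurd hy h⟩
      · exact (Ioo_subset_Ioo hec.le hdf.le).trans hsub
      · rcases hh with hh | hh
        · exact absurd hy (hh a hua haw y hcy hyd)
        · filter_upwards [Ioo_mem_nhds hua haw] with x hx
          obtain ⟨z, h1, h2, h3, h4⟩ := hh x hx.1 hx.2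
          exact ⟨z, ⟨h1, h2⟩, h3, fun z' hz' => h4 z' hz'.1 hz'.2⟩
    · have : {z | Y a z}ᶜ ∈ 𝓝 y := (hfin a).isClosed.isOpen_compl.mem_nhds hy
      obtain ⟨e, f, ⟨he, hf⟩, hsub⟩ := mem_nhds_iff_exists_Ioo_subset.1 this
      obtain ⟨c, d, u, w, hec, hcy, hyd, hdf, hua, haw, hh⟩ := h y e f he hf
      refine ⟨Ioo c d, isOpen_Ioo, ⟨hcy, hyd⟩, fun h => absurd h hy, fun _ => ?_⟩
      rcases hh with hh | hh
      · filter_upwards [Ioo_mem_nhds hua haw] with x hx z hz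
        exact hh x hx.1 hx.2 z hz.1 hz.2
      · obtain ⟨z, h1, h2, h3, h4⟩ := hh a hua haw
        exact absurd h3 (hsub ⟨hec.trans h1, h2.trans hdf⟩)
  choose V hVo hyV hV1 hV2 using h1
  have hK : IsCompact (Icc p q \ ⋃ y ∈ {y | Y a y}, V y) :=
    isCompact_Icc.diff (isOpen_biUnion fun y _ => hVo y)
  have hE := hK.eventually_forall_of_forall_eventually (x₀ := a) (P := fun x z => ¬ Y x z) (by
    intro y hy
    have hya : ¬ Y a y := fun hya => hy.2 (mem_biUnion (x := y) hya (hyV y))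
    rw [nhds_prod_eq]
    have := (hV2 y hya).prod_mk ((hVo y).mem_nhds (hyV y) : ∀ᶠ z in 𝓝 y, z ∈ V y)
    exact this.mono fun z hz => hz.1 _ hz.2)
  have hF : ∀ᶠ x in 𝓝 a, ∀ y ∈ {y | Y a y}, ∃ z ∈ V y, Y x z ∧ ∀ z' ∈ V y, Y x z' → z' = z := by
    rw [Filter.eventually_all_finite (hfin a)]
    intro y hy
    exact (hV1 y hy).2
  filter_upwards [hE, hF] with x hx1 hx2
  choose! g hgV hgY hgu using hx2
  symm
  refine Set.ncard_congr (fun y _ => g y) ?_ ?_ ?_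
  · intro y hy; exact hgY y hy
  · intro y y' hy hy' hgg
    by_contra hne
    have := hdis hy hy' hne
    exact Set.disjoint_left.1 this ((hV1 y hy).1 (hgV y hy))
      ((hV1 y' hy').1 (by have := hgV y' hy'; rwa [← hgg] at this))
  · intro z hz
    have : z ∈ ⋃ y ∈ {y | Y a y}, V y := by
      by_contra hn
      exact hx1 z ⟨hb x z hz, hn⟩ hz
    simp only [mem_iUnion] at this
    obtain ⟨y, hy, hzV⟩ := this
    exact ⟨y, hy, (hgu y hy z hzV hz).symm⟩

lemma countable_bad {Y : ℝ → ℝ → Prop} (hfin : ∀ x, {y | Y x y}.Finite)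
    (h0 : ∀ c d, TameSet {x | NoneB Y c d x}) (h1 : ∀ c d, TameSet {x | OneB Y c d x}) :
    {a | ¬ GoodAt Y a}.Countable := by
  have hc : (⋃ r : ℚ × ℚ, (frontier {x | NoneB Y r.1 r.2 x} ∪
      frontier {x | OneB Y r.1 r.2 x})).Countable :=
    countable_iUnion fun r => (h0 _ _).countable_frontier.union (h1 _ _).countable_frontier
  refine hc.mono ?_
  intro a ha
  by_contra hn
  apply ha
  simp only [mem_iUnion, not_exists, mem_union, not_or] at hn
  intro y e f he hf
  have hnh : ({z | Y a z} \ {y})ᶜ ∈ 𝓝 y :=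
    ((hfin a).sdiff).isClosed.isOpen_compl.mem_nhds (by simp)
  obtain ⟨e', f', ⟨he', hf'⟩, hsub⟩ := mem_nhds_iff_exists_Ioo_subset.1 hnh
  obtain ⟨c, hc1, hc2⟩ := exists_rat_btwn (max_lt he he')
  obtain ⟨d, hd1, hd2⟩ := exists_rat_btwn (lt_min hf hf')
  have hcd : ∀ z, (c : ℝ) < z → z < d → Y a z → z = y := by
    intro z hz1 hz2 hz
    by_contra hne
    exact hsub ⟨(le_max_right _ _).trans_lt (hc1.trans hz1),
      (hz2.trans hd2).trans_le (min_le_right _ _)⟩ ⟨hz, hne⟩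
  have key : ∀ S : Set ℝ, a ∈ S → a ∉ frontier S → ∃ u w, u < a ∧ a < w ∧
      ∀ x, u < x → x < w → x ∈ S := by
    intro S haS haf
    have : a ∈ interior S := by
      by_contra hni
      exact haf ⟨subset_closure haS, hni⟩
    obtain ⟨u, w, ⟨h1, h2⟩, hs⟩ :=
      mem_nhds_iff_exists_Ioo_subset.1 (mem_interior_iff_mem_nhds.1 this)
    exact ⟨u, w, h1, h2, fun x hx1 hx2 => hs ⟨hx1, hx2⟩⟩
  have hec := (le_max_left _ _).trans_lt hc1
  have hdf := hd2.trans_le (min_le_left _ _)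
  by_cases hy : Y a y
  · obtain ⟨u, w, hu, hw, hh⟩ := key {x | OneB Y c d x}
      ⟨y, hc2, hd1, hy, hcd⟩ (hn (c, d)).2
    exact ⟨c, d, u, w, hec, hc2, hd1, hdf, hu, hw, Or.inr hh⟩
  · obtain ⟨u, w, hu, hw, hh⟩ := key {x | NoneB Y c d x}
      (fun z hz1 hz2 hz => hy (hcd z hz1 hz2 hz ▸ hz)) (hn (c, d)).1
    exact ⟨c, d, u, w, hec, hc2, hd1, hdf, hu, hw, Or.inl hh⟩

/-- A definable countable set of representatives. -/
def RepAt (Y : ℝ → ℝ → Prop) (x : ℝ) : Prop :=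
  (∃ s t r, ¬ GoodAt Y s ∧ ¬ GoodAt Y t ∧ s + t = r ∧ x + x = r) ∨
  (∃ s o, ¬ GoodAt Y s ∧ o = 1 ∧ s + o = x) ∨
  (∃ s o, ¬ GoodAt Y s ∧ o = 1 ∧ x + o = s) ∨ x = 0

lemma countable_rep {Y : ℝ → ℝ → Prop} (h : {a | ¬ GoodAt Y a}.Countable) :
    {x | RepAt Y x}.Countable := by
  have : {x | RepAt Y x} ⊆ image2 (fun s t => (s + t) / 2) {a | ¬ GoodAt Y a} {a | ¬ GoodAt Y a} ∪
      ((fun s => s + 1) '' {a | ¬ GoodAt Y a} ∪ ((fun s => s - 1) '' {a | ¬ GoodAt Y a} ∪ {0})) := by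
    rintro x (⟨s, t, r, hs, ht, h1, h2⟩ | ⟨s, o, hs, ho, h1⟩ | ⟨s, o, hs, ho, h1⟩ | h)
    · exact Or.inl ⟨s, hs, t, ht, by simp only; linarith⟩
    · exact Or.inr (Or.inl ⟨s, hs, by simp only; linarith⟩)
    · exact Or.inr (Or.inr (Or.inl ⟨s, hs, by simp only; linarith⟩))
    · exact Or.inr (Or.inr (Or.inr h))
  exact ((h.image2 h _).union ((h.image _).union ((h.image _).union (countable_singleton _)))).mono
    this

lemma exists_rep {Y : ℝ → ℝ → Prop} {p q : ℝ} (hcl : IsClosed {a | ¬ GoodAt Y a})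
    (hfin : ∀ x, {y | Y x y}.Finite) (hb : ∀ x y, Y x y → y ∈ Icc p q) (x : ℝ) :
    ∃ x', RepAt Y x' ∧ {y | Y x y}.ncard = {y | Y x' y}.ncard := by
  set B := {a | ¬ GoodAt Y a} with hB
  by_cases hx : x ∈ B
  · exact ⟨x, Or.inl ⟨x, x, x + x, hx, hx, rfl, rfl⟩, rfl⟩
  have hconst : ∀ x', (∀ z ∈ uIcc x x', z ∉ B) → {y | Y x y}.ncard = {y | Y x' y}.ncard := by
    intro x' hz
    refine isPreconnected_uIcc.constant (f := fun x => {y | Y x y}.ncard) ?_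
      left_mem_uIcc right_mem_uIcc
    intro z hzz
    apply ContinuousAt.continuousWithinAt
    have hg : GoodAt Y z := by simpa [hB] using hz z hzz
    have := hg.eventually_ncard hfin hb
    exact tendsto_const_nhds.congr' (this.mono fun _ h => h.symm)
  have hR : (B ∩ Ici x).Nonempty → ∃ t ∈ B, x < t ∧ ∀ z, x ≤ z → z < t → z ∉ B := by
    intro hne
    have hbd : BddBelow (B ∩ Ici x) := ⟨x, fun z hz => hz.2⟩
    have hm := (hcl.inter isClosed_Ici).csInf_mem hne hbd
    refine ⟨_, hm.1, lt_of_le_of_ne hm.2 (fun h => hx (h ▸ hm.1)), ?_⟩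
    intro z hz1 hz2 hz
    exact absurd (csInf_le hbd ⟨hz, hz1⟩) (not_le.2 hz2)
  have hL : (B ∩ Iic x).Nonempty → ∃ t ∈ B, t < x ∧ ∀ z, z ≤ x → t < z → z ∉ B := by
    intro hne
    have hbd : BddAbove (B ∩ Iic x) := ⟨x, fun z hz => hz.2⟩
    have hm := (hcl.inter isClosed_Iic).csSup_mem hne hbd
    refine ⟨_, hm.1, lt_of_le_of_ne hm.2 (fun h => hx (h ▸ hm.1)), ?_⟩
    intro z hz1 hz2 hz
    exact absurd (le_csSup hbd ⟨hz, hz1⟩) (not_le.2 hz2)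
  have comb : ∀ x', (∀ z, x ≤ z → z ≤ x' → z ∉ B) → (∀ z, z ≤ x → x' ≤ z → z ∉ B) →
      {y | Y x y}.ncard = {y | Y x' y}.ncard := by
    intro x' h1 h2
    refine hconst x' fun z hz => ?_
    rcases mem_uIcc.1 hz with h | h
    · exact h1 z h.1 h.2
    · exact h2 z h.2 h.1
  rcases (B ∩ Ici x).eq_empty_or_nonempty with h1 | h1 <;>
  rcases (B ∩ Iic x).eq_empty_or_nonempty with h2 | h2
  · refine ⟨0, Or.inr (Or.inr (Or.inr rfl)), comb _ ?_ ?_⟩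
    · intro z hz _ hzB
      exact (h1 ▸ (⟨hzB, hz⟩ : z ∈ B ∩ Ici x) : z ∈ (∅ : Set ℝ))
    · intro z hz _ hzB
      exact (h2 ▸ (⟨hzB, hz⟩ : z ∈ B ∩ Iic x) : z ∈ (∅ : Set ℝ))
  · obtain ⟨s, hs, hsx, hs'⟩ := hL h2
    refine ⟨s + 1, Or.inr (Or.inl ⟨s, 1, hs, rfl, rfl⟩), comb _ ?_ ?_⟩
    · intro z hz _ hzB
      exact (h1 ▸ (⟨hzB, hz⟩ : z ∈ B ∩ Ici x) : z ∈ (∅ : Set ℝ))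
    · intro z hz hz'
      exact hs' z hz (by linarith)
  · obtain ⟨t, ht, hxt, ht'⟩ := hR h1
    refine ⟨t - 1, Or.inr (Or.inr (Or.inl ⟨t, 1, ht, rfl, by ring⟩)), comb _ ?_ ?_⟩
    · intro z hz hz'
      exact ht' z hz (by linarith)
    · intro z hz _ hzB
      exact (h2 ▸ (⟨hzB, hz⟩ : z ∈ B ∩ Iic x) : z ∈ (∅ : Set ℝ))
  · obtain ⟨s, hs, hsx, hs'⟩ := hL h2
    obtain ⟨t, ht, hxt, ht'⟩ := hR h1
    refine ⟨(s + t) / 2, Or.inl ⟨s, t, s + t, hs, ht, rfl, by ring⟩, comb _ ?_ ?_⟩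
    · intro z hz hz'
      exact ht' z hz (by linarith)
    · intro z hz hz'
      exact hs' z hz (by linarith)

/-- Definable predicates, in variables indexed by an arbitrary type. -/
def DefP (L : FirstOrder.Language) [L.Structure ℝ] {α : Type} (P : (α → ℝ) → Prop) : Prop :=
  Set.Definable (Set.univ : Set ℝ) L {v : α → ℝ | P v}

section DefinablePredicates

variable {L : FirstOrder.Language} [L.Structure ℝ] {α β : Type}

lemma DefP.and {P Q : (α → ℝ) → Prop} (hP : DefP L P) (hQ : DefP L Q) :
    DefP L (fun v => P v ∧ Q v) := Set.Definable.inter hP hQ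

lemma DefP.or {P Q : (α → ℝ) → Prop} (hP : DefP L P) (hQ : DefP L Q) :
    DefP L (fun v => P v ∨ Q v) := Set.Definable.union hP hQ

lemma DefP.not {P : (α → ℝ) → Prop} (hP : DefP L P) :
    DefP L (fun v => ¬ P v) := Set.Definable.compl hP

lemma DefP.congr {P Q : (α → ℝ) → Prop} (hP : DefP L P) (h : ∀ v, P v ↔ Q v) : DefP L Q := by
  have : P = Q := funext fun v => propext (h v)
  exact this ▸ hP

lemma DefP.imp {P Q : (α → ℝ) → Prop} (hP : DefP L P) (hQ : DefP L Q) :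
    DefP L (fun v => P v → Q v) :=
  (hP.not.or hQ).congr fun v => by tauto

lemma DefP.pre {P : (α → ℝ) → Prop} (hP : DefP L P) (g : α → β) :
    DefP L (fun w : β → ℝ => P (fun i => w (g i))) := Set.Definable.preimage_comp g hP

lemma DefP.ex {P : (α → ℝ) → ℝ → Prop}
    (hP : DefP L (fun w : Option α → ℝ => P (fun i => w (some i)) (w none))) :
    DefP L (fun v => ∃ y, P v y) := by
  have h := hP.pre (fun o : Option α => o.elim (Sum.inr ()) Sum.inl : Option α → α ⊕ Unit)
  obtain ⟨φ, hφ⟩ := h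
  refine ⟨φ.iExs Unit, ?_⟩
  ext v
  simp only [mem_ofPred_eq, FirstOrder.Language.Formula.realize_iExs]
  have hh : ∀ w, φ.Realize w ↔ P (fun i => w (Sum.inl i)) (w (Sum.inr ())) := by
    intro w
    have := Set.ext_iff.1 hφ w
    simpa using this.symm
  simp only [hh, Sum.elim_inl, Sum.elim_inr]
  exact ⟨fun ⟨y, hy⟩ => ⟨fun _ => y, hy⟩, fun ⟨y, hy⟩ => ⟨y (), hy⟩⟩

lemma DefP.all {P : (α → ℝ) → ℝ → Prop}
    (hP : DefP L (fun w : Option α → ℝ => P (fun i => w (some i)) (w none))) :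
    DefP L (fun v => ∀ y, P v y) :=
  (DefP.ex (P := fun v y => ¬ P v y) hP.not).not.congr fun v => by simp

lemma DefP.eqc (i : α) (r : ℝ) : DefP L (fun v => v i = r) := by
  refine ⟨FirstOrder.Language.Term.equal (FirstOrder.Language.Term.var i)
    (FirstOrder.Language.Constants.term (L.con (⟨r, trivial⟩ : (Set.univ : Set ℝ)))), ?_⟩
  ext v
  simp [FirstOrder.Language.Formula.realize_equal]

lemma DefP.eqv (i j : α) : DefP L (fun v => v i = v j) := by
  refine ⟨FirstOrder.Language.Term.equal (FirstOrder.Language.Term.var i)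
    (FirstOrder.Language.Term.var j), ?_⟩
  ext v
  simp [FirstOrder.Language.Formula.realize_equal]

lemma DefP.spec {X : (α → ℝ) → ℝ → Prop}
    (hX : DefP L (fun w : Option α → ℝ => X (fun i => w (some i)) (w none))) (v : α → ℝ) :
    DefP L (fun w : Fin 1 → ℝ => X v (w 0)) := by
  obtain ⟨φ, hφ⟩ := hX
  refine ⟨FirstOrder.Language.BoundedFormula.subst φ (fun o : Option α =>
    o.elim (FirstOrder.Language.Term.var 0) (fun i =>
      FirstOrder.Language.Constants.term (L.con (⟨v i, trivial⟩ : (Set.univ : Set ℝ))))), ?_⟩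
  ext w
  have hh : ∀ w, φ.Realize w ↔ X (fun i => w (some i)) (w none) := by
    intro w
    have := Set.ext_iff.1 hφ w
    simpa using this.symm
  simp only [mem_ofPred_eq, FirstOrder.Language.Formula.Realize,
    FirstOrder.Language.BoundedFormula.realize_subst]
  have := hh (fun o : Option α => o.elim (w 0) v)
  simp only [Option.elim] at this
  rw [← this, FirstOrder.Language.Formula.Realize]
  apply iff_of_eq
  congr 1
  funext o
  cases o <;> simp

end DefinablePredicates

section MainArgument

variable {L : FirstOrder.Language} [L.Structure ℝ] {α β : Type}

lemma DefP.lt (hlt : IsDefinable L {v : Fin 2 → ℝ | v 0 < v 1}) (i j : α) :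
    DefP L (fun v => v i < v j) :=
  DefP.pre (P := fun v : Fin 2 → ℝ => v 0 < v 1) hlt ![i, j]

lemma DefP.le (hlt : IsDefinable L {v : Fin 2 → ℝ | v 0 < v 1}) (i j : α) :
    DefP L (fun v => v i ≤ v j) :=
  (DefP.lt hlt j i).not.congr fun _ => not_lt

lemma DefP.add (hadd : IsDefinable L {v : Fin 3 → ℝ | v 0 + v 1 = v 2}) (i j k : α) :
    DefP L (fun v => v i + v j = v k) :=
  DefP.pre (P := fun v : Fin 3 → ℝ => v 0 + v 1 = v 2) hadd ![i, j, k]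

lemma DefP.lec (hlt : IsDefinable L {v : Fin 2 → ℝ | v 0 < v 1}) (i : α) (r : ℝ) :
    DefP L (fun v => v i ≤ r) :=
  DefP.congr (P := fun v => ∃ y, y = r ∧ v i ≤ y)
    (DefP.ex ((DefP.eqc none r).and (DefP.le hlt (some i) none))) fun v => by simp

lemma DefP.cle (hlt : IsDefinable L {v : Fin 2 → ℝ | v 0 < v 1}) (i : α) (r : ℝ) :
    DefP L (fun v => r ≤ v i) :=
  DefP.congr (P := fun v => ∃ y, y = r ∧ y ≤ v i)
    (DefP.ex ((DefP.eqc none r).and (DefP.le hlt none (some i)))) fun v => by simp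

lemma DefP.app3 {X : (α → ℝ) → ℝ → ℝ → Prop}
    (hX : DefP L (fun w : Option (Option α) → ℝ =>
      X (fun i => w (some (some i))) (w (some none)) (w none)))
    (g : α → β) (j k : β) : DefP L (fun w : β → ℝ => X (fun i => w (g i)) (w j) (w k)) :=
  hX.pre (fun o : Option (Option α) => o.elim k (fun o => o.elim j g))

lemma DefP.noneB (hlt : IsDefinable L {v : Fin 2 → ℝ | v 0 < v 1})
    {X : (α → ℝ) → ℝ → ℝ → Prop}
    (hX : DefP L (fun w : Option (Option α) → ℝ =>
      X (fun i => w (some (some i))) (w (some none)) (w none)))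
    (g : α → β) (c d x : β) :
    DefP L (fun w : β → ℝ => NoneB (X (fun i => w (g i))) (w c) (w d) (w x)) := by
  unfold NoneB
  exact DefP.all ((DefP.lt hlt (some c) none).imp ((DefP.lt hlt none (some d)).imp
    (DefP.app3 hX (fun i => some (g i)) (some x) none).not))

lemma DefP.oneB (hlt : IsDefinable L {v : Fin 2 → ℝ | v 0 < v 1})
    {X : (α → ℝ) → ℝ → ℝ → Prop}
    (hX : DefP L (fun w : Option (Option α) → ℝ =>
      X (fun i => w (some (some i))) (w (some none)) (w none)))
    (g : α → β) (c d x : β) :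
    DefP L (fun w : β → ℝ => OneB (X (fun i => w (g i))) (w c) (w d) (w x)) := by
  unfold OneB
  exact DefP.ex ((DefP.lt hlt (some c) none).and ((DefP.lt hlt none (some d)).and
    ((DefP.app3 hX (fun i => some (g i)) (some x) none).and (DefP.all
      ((DefP.lt hlt (some (some c)) none).imp ((DefP.lt hlt none (some (some d))).imp
        ((DefP.app3 hX (fun i => some (some (g i))) (some (some x)) none).imp
          (DefP.eqv none (some none)))))))))

lemma DefP.goodAt (hlt : IsDefinable L {v : Fin 2 → ℝ | v 0 < v 1})
    {X : (α → ℝ) → ℝ → ℝ → Prop}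
    (hX : DefP L (fun w : Option (Option α) → ℝ =>
      X (fun i => w (some (some i))) (w (some none)) (w none)))
    (g : α → β) (a : β) :
    DefP L (fun w : β → ℝ => GoodAt (X (fun i => w (g i))) (w a)) := by
  unfold GoodAt
  refine DefP.all (DefP.all (DefP.all ?_))
  refine (DefP.lt hlt (some none) (some (some none))).imp ?_
  refine (DefP.lt hlt (some (some none)) none).imp ?_
  refine DefP.ex (DefP.ex (DefP.ex (DefP.ex ?_)))
  -- variables: w = 0, u = 1, d = 2, c = 3, f = 4, e = 5, y = 6, then the old ones
  refine (DefP.lt hlt (some (some (some (some (some none))))) (some (some (some none)))).and ?_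
  refine (DefP.lt hlt (some (some (some none))) (some (some (some (some (some (some none))))))).and
    ?_
  refine (DefP.lt hlt (some (some (some (some (some (some none)))))) (some (some none))).and ?_
  refine (DefP.lt hlt (some (some none)) (some (some (some (some none))))).and ?_
  refine (DefP.lt hlt (some none) (some (some (some (some (some (some (some a)))))))).and ?_
  refine (DefP.lt hlt (some (some (some (some (some (some (some a))))))) none).and ?_
  refine DefP.or (DefP.all ?_) (DefP.all ?_)
  · refine (DefP.lt hlt (some (some none)) none).imp ((DefP.lt hlt none (some none)).imp ?_)
    exact DefP.noneB hlt hX (fun i => some (some (some (some (some (some (some (some (g i)))))))))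
      (some (some (some (some none)))) (some (some (some none))) none
  · refine (DefP.lt hlt (some (some none)) none).imp ((DefP.lt hlt none (some none)).imp ?_)
    exact DefP.oneB hlt hX (fun i => some (some (some (some (some (some (some (some (g i)))))))))
      (some (some (some (some none)))) (some (some (some none))) none

lemma DefP.repAt (hlt : IsDefinable L {v : Fin 2 → ℝ | v 0 < v 1})
    (hadd : IsDefinable L {v : Fin 3 → ℝ | v 0 + v 1 = v 2})
    {X : (α → ℝ) → ℝ → ℝ → Prop}
    (hX : DefP L (fun w : Option (Option α) → ℝ =>
      X (fun i => w (some (some i))) (w (some none)) (w none)))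
    (g : α → β) (a : β) :
    DefP L (fun w : β → ℝ => RepAt (X (fun i => w (g i))) (w a)) := by
  unfold RepAt
  refine DefP.or ?_ (DefP.or ?_ (DefP.or ?_ (DefP.eqc a 0)))
  · refine DefP.ex (DefP.ex (DefP.ex ?_))
    refine (DefP.goodAt hlt hX (fun i => some (some (some (g i)))) (some (some none))).not.and ?_
    refine (DefP.goodAt hlt hX (fun i => some (some (some (g i)))) (some none)).not.and ?_
    exact (DefP.add hadd (some (some none)) (some none) none).and
      (DefP.add hadd (some (some (some a))) (some (some (some a))) none)
  · refine DefP.ex (DefP.ex ?_)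
    refine (DefP.goodAt hlt hX (fun i => some (some (g i))) (some none)).not.and ?_
    exact (DefP.eqc none 1).and (DefP.add hadd (some none) none (some (some a)))
  · refine DefP.ex (DefP.ex ?_)
    refine (DefP.goodAt hlt hX (fun i => some (some (g i))) (some none)).not.and ?_
    exact (DefP.eqc none 1).and (DefP.add hadd (some (some a)) none (some none))

/-- Uniform finiteness for bounded families with parameters indexed by `α`. -/
def UnifBd (L : FirstOrder.Language) [L.Structure ℝ] (p q : ℝ) (α : Type) : Prop :=
  ∀ X : (α → ℝ) → ℝ → Prop,
    DefP L (fun w : Option α → ℝ => X (fun i => w (some i)) (w none)) →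
    (∀ v, {y | X v y}.Finite) → (∀ v y, X v y → y ∈ Icc p q) →
    ∃ N : ℕ, ∀ v, {y | X v y}.ncard ≤ N

lemma UnifBd.option (hlt : IsDefinable L {v : Fin 2 → ℝ | v 0 < v 1})
    (hadd : IsDefinable L {v : Fin 3 → ℝ | v 0 + v 1 = v 2})
    (htame : ∀ S : Set ℝ, DefP L (fun w : Fin 1 → ℝ => w 0 ∈ S) → TameSet S)
    {p q : ℝ} (h : UnifBd L p q α) : UnifBd L p q (Option α) := by
  intro X₀ hX₀ hfin₀ hb₀
  let X : (α → ℝ) → ℝ → ℝ → Prop := fun v x y => X₀ (fun o => o.elim x v) y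
  have hX : DefP L (fun w : Option (Option α) → ℝ =>
      X (fun i => w (some (some i))) (w (some none)) (w none)) := by
    refine hX₀.congr fun w => ?_
    have : (fun i => w (some i)) =
      (fun o : Option α => o.elim (w (some none)) (fun i => w (some (some i)))) := by
      funext o; cases o <;> rfl
    simp only [X]
    rw [this]
  have hfin : ∀ v x, {y | X v x y}.Finite := fun v x => hfin₀ _
  have hb : ∀ v x y, X v x y → y ∈ Icc p q := fun v x y => hb₀ _ y
  have hbad : ∀ v, {a | ¬ GoodAt (X v) a}.Countable := by
    intro v
    refine countable_bad (hfin v) ?_ ?_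
    · intro c d
      exact htame _ (DefP.spec (α := Option (Option α))
        (X := fun v x => NoneB (X (fun i => v (some (some i)))) (v (some none)) (v none) x)
        (DefP.noneB hlt hX (fun i => some (some (some i))) (some (some none)) (some none) none)
        (fun o => o.elim d (fun o => o.elim c v)))
    · intro c d
      exact htame _ (DefP.spec (α := Option (Option α))
        (X := fun v x => OneB (X (fun i => v (some (some i)))) (v (some none)) (v none) x)
        (DefP.oneB hlt hX (fun i => some (some (some i))) (some (some none)) (some none) none)
        (fun o => o.elim d (fun o => o.elim c v)))
  have hcl : ∀ v, IsClosed {a | ¬ GoodAt (X v) a} := by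
    intro v
    refine TameSet.isClosed (htame _ ?_) (interior_empty_of_countable (hbad v))
    exact DefP.spec (X := fun v x => ¬ GoodAt (X v) x) (DefP.goodAt hlt hX some none).not v
  let Z : (α → ℝ) → ℝ → Prop := fun v y => ∃ x, RepAt (X v) x ∧ X v x y
  have hZ : DefP L (fun w : Option α → ℝ => Z (fun i => w (some i)) (w none)) :=
    DefP.ex ((DefP.repAt hlt hadd hX (fun i => some (some i)) none).and
      (DefP.app3 hX (fun i => some (some i)) none (some none)))
  have hZb : ∀ v y, Z v y → y ∈ Icc p q := fun v y ⟨x, _, hx⟩ => hb v x y hx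
  have hZfin : ∀ v, {y | Z v y}.Finite := by
    intro v
    have hc : {y | Z v y}.Countable := by
      refine ((countable_rep (hbad v)).biUnion (t := fun x _ => {y | X v x y})
        fun x _ => (hfin v x).countable).mono ?_
      rintro y ⟨x, h1, h2⟩
      exact mem_biUnion (x := x) h1 h2
    have := (htame _ (DefP.spec hZ v)).finite_inter (interior_empty_of_countable hc) p q
    exact this.subset fun y hy => ⟨hy, hZb v y hy⟩
  obtain ⟨N, hN⟩ := h Z hZ hZfin hZb
  refine ⟨N, fun w => ?_⟩
  let v : α → ℝ := fun i => w (some i)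
  obtain ⟨x', hx', hcard⟩ := exists_rep (hcl v) (hfin v) (hb v) (w none)
  have hw : w = fun o : Option α => o.elim (w none) v := by
    funext o; cases o <;> rfl
  calc {y | X₀ w y}.ncard = {y | X v (w none) y}.ncard := by simp only [X]; rw [← hw]
    _ = {y | X v x' y}.ncard := hcard
    _ ≤ {y | Z v y}.ncard := Set.ncard_le_ncard (fun y hy => ⟨x', hx', hy⟩) (hZfin v)
    _ ≤ N := hN v

lemma unifBd_all (hlt : IsDefinable L {v : Fin 2 → ℝ | v 0 < v 1})
    (hadd : IsDefinable L {v : Fin 3 → ℝ | v 0 + v 1 = v 2})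
    (htame : ∀ S : Set ℝ, DefP L (fun w : Fin 1 → ℝ => w 0 ∈ S) → TameSet S)
    (p q : ℝ) (α : Type) [Finite α] : UnifBd L p q α := by
  refine Finite.induction_empty_option (P := fun α => UnifBd L p q α) ?_ ?_ ?_ α
  · intro α β e h X hX hfin hb
    obtain ⟨N, hN⟩ := h (fun v y => X (fun b => v (e.symm b)) y)
      (hX.pre (fun o : Option β => o.map e.symm)) (fun v => hfin _) (fun v => hb _)
    refine ⟨N, fun v => ?_⟩
    simpa using hN (fun a => v (e a))
  · intro X _ _ _
    exact ⟨{y | X (fun i => i.elim) y}.ncard, fun v => by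
      rw [Subsingleton.elim v (fun i => i.elim)]⟩
  · intro α _ h
    exact h.option hlt hadd htame

end MainArgument

/-- Let `𝓡̃` be a locally o-minimal expansion of the ordered additive
group of the reals. Then `𝓡̃ ⊨ SLUF`: for every `a ∈ ℝ` there is a closed interval `I`
with `a ∈ int(I)`, independent of the definable set, such that for every definable
`X ⊆ ℝ^{m+1}` there is a positive integer `N` with `|X_x ∩ J| = ∞` or `|X_x ∩ J| ≤ N`
for all `x ∈ ℝ^m` and all closed intervals `J` with `a ∈ int(J) ⊆ I`. -/
theorem locallyOMinimal_real_expansion_SLUF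
    (L : FirstOrder.Language) [L.Structure ℝ]
    (hlt : IsDefinable L {v : Fin 2 → ℝ | v 0 < v 1})
    (hadd : IsDefinable L {v : Fin 3 → ℝ | v 0 + v 1 = v 2})
    (hlom : ∀ X : Set (Fin 1 → ℝ), IsDefinable L X → ∀ a : ℝ,
      ∃ c d : ℝ, c < a ∧ a < d ∧
        FinUnionPtsIntervals ({y : ℝ | (fun _ => y) ∈ X} ∩ Set.Ioo c d)) :
    SLUF L ℝ := by
  have htame : ∀ S : Set ℝ, DefP L (fun w : Fin 1 → ℝ => w 0 ∈ S) → TameSet S :=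
    fun S hS => hlom _ hS
  intro a
  refine ⟨a - 1, a + 1, by rw [interior_Icc]; constructor <;> linarith, ?_⟩
  intro m X hX
  have hsnoc : ∀ {β : Type} (g : Fin m → β) (k : β),
      DefP L (fun w : β → ℝ => (Fin.snoc (fun i => w (g i)) (w k) : Fin (m + 1) → ℝ) ∈ X) := by
    intro β g k
    have h := DefP.pre (P := fun v => v ∈ X) hX (Fin.snoc (α := fun _ => β) g k)
    refine h.congr fun w => ?_
    have : (fun i => w (Fin.snoc (α := fun _ => β) g k i)) =
        (Fin.snoc (fun i => w (g i)) (w k) : Fin (m + 1) → ℝ) := by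
      funext i
      refine Fin.lastCases ?_ (fun j => ?_) i <;> simp
    rw [this]
  -- parameters: `x`, `p' = some none`, `q' = none`
  let S : (Option (Option (Fin m)) → ℝ) → ℝ → Prop := fun v y =>
    (v (some none) ≤ y ∧ y ≤ v none ∧ a - 1 ≤ y ∧ y ≤ a + 1) ∧
      (Fin.snoc (fun i => v (some (some i))) y : Fin (m + 1) → ℝ) ∈ X
  have hS : ∀ {β : Type} (g : Option (Option (Fin m)) → β) (k : β),
      DefP L (fun w : β → ℝ => S (fun i => w (g i)) (w k)) := fun g k =>
    ((DefP.le hlt _ _).and ((DefP.le hlt _ _).and ((DefP.cle hlt _ _).and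
      (DefP.lec hlt _ _)))).and (hsnoc (fun i => g (some (some i))) k)
  let Z : (Option (Option (Fin m)) → ℝ) → ℝ → Prop := fun v y =>
    S v y ∧ ∀ c d, c < d → ∃ z, c < z ∧ z < d ∧ ¬ S v z
  have hZ : DefP L (fun w : Option (Option (Option (Fin m))) → ℝ =>
      Z (fun i => w (some i)) (w none)) := by
    refine (hS some none).and (DefP.all (DefP.all ?_))
    refine (DefP.lt hlt (some none) none).imp (DefP.ex ?_)
    exact (DefP.lt hlt (some (some none)) none).and ((DefP.lt hlt none (some none)).and
      (hS (fun i => some (some (some (some i)))) none).not)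
  have hZb : ∀ v y, Z v y → y ∈ Icc (a - 1) (a + 1) := fun v y h => h.1.1.2.2
  have hZfin : ∀ v, {y | Z v y}.Finite := by
    intro v
    by_cases hv : ∀ c d, c < d → ∃ z, c < z ∧ z < d ∧ ¬ S v z
    · have hi : interior {y | S v y} = ∅ := by
        rw [eq_empty_iff_forall_notMem]
        intro y hy
        obtain ⟨c, d, ⟨hc, hd⟩, hs⟩ :=
          mem_nhds_iff_exists_Ioo_subset.1 (mem_interior_iff_mem_nhds.1 hy)
        obtain ⟨z, h1, h2, h3⟩ := hv c d (hc.trans hd)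
        exact h3 (hs ⟨h1, h2⟩)
      have := (htame _ (DefP.spec (hS some none) v)).finite_inter hi (a - 1) (a + 1)
      exact this.subset fun y hy => ⟨hy.1, hZb v y hy⟩
    · exact Set.finite_empty.subset fun y hy => hv hy.2
  obtain ⟨N, hN⟩ := unifBd_all hlt hadd htame (a - 1) (a + 1) _ Z hZ hZfin hZb
  refine ⟨N + 1, Nat.succ_pos _, ?_⟩
  intro x p' q' _ hsub
  by_cases hinf : (fiber1 X x ∩ Set.Icc p' q').Infinite
  · exact Or.inl hinf
  right
  rw [Set.not_infinite] at hinf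
  let v : Option (Option (Fin m)) → ℝ := fun o => o.elim q' (fun o => o.elim p' x)
  have hSv : {y | S v y} = fiber1 X x ∩ Set.Icc p' q' := by
    ext y
    constructor
    · intro hy
      exact ⟨hy.2, hy.1.1, hy.1.2.1⟩
    · intro hy
      exact ⟨⟨hy.2.1, hy.2.2, (hsub hy.2).1, (hsub hy.2).2⟩, hy.1⟩
  have hZv : {y | Z v y} = fiber1 X x ∩ Set.Icc p' q' := by
    rw [← hSv]
    ext y
    refine ⟨fun hy => hy.1, fun hy => ⟨hy, fun c d hcd => ?_⟩⟩
    by_contra hcon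
    push Not at hcon
    refine Set.Ioo_infinite hcd (Set.Finite.subset (hSv ▸ hinf : {y | S v y}.Finite) ?_)
    intro z hz
    exact hcon z hz.1 hz.2
  rw [← hZv]
  exact (hN v).trans (Nat.le_succ _)
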